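/- In the right-angled augmented-word setting: if w is a regular augmented word and w' is obtained from w by one augmented special transformation (of type 0, 1, 2, or ∞), then w' is regular. -/

import Mathlib

namespace ArtinConj

/-- A word over `S ∪ S⁻¹`. -/
abbrev Word (S : Type) := List (S × Bool)

/-- The type of a special transformation: `0`, `1`, `2`, or `∞`. -/
inductive TType : Type
  | t0 | t1 | t2 | tinf
  deriving DecidableEq

/-- Special transformations on words for a right-angled presentation whose
commutation relations are given by `rel` : type `0` removes a trivial pair,
types `1` and `2` commute adjacent letters (with equal, resp. opposite, signs)
whose generators commute, and type `∞` inserts a trivial pair. -/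
inductive RStep {S : Type} (rel : S → S → Prop) : TType → Word S → Word S → Prop
  | free (w₁ w₂ : Word S) (s : S) (e : Bool) :
      RStep rel .t0 (w₁ ++ [(s, e), (s, !e)] ++ w₂) (w₁ ++ w₂)
  | comm1 (w₁ w₂ : Word S) (s t : S) (e : Bool) (h : rel s t) :
      RStep rel .t1 (w₁ ++ [(s, e), (t, e)] ++ w₂) (w₁ ++ [(t, e), (s, e)] ++ w₂)
  | comm2 (w₁ w₂ : Word S) (s t : S) (e : Bool) (h : rel s t) :
      RStep rel .t2 (w₁ ++ [(s, e), (t, !e)] ++ w₂) (w₁ ++ [(t, !e), (s, e)] ++ w₂)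
  | ins (w₁ w₂ : Word S) (s : S) (e : Bool) :
      RStep rel .tinf (w₁ ++ w₂) (w₁ ++ [(s, e), (s, !e)] ++ w₂)

/-- An augmented word: letters carry an index (their "age"). -/
abbrev AWord (S : Type) := List ((S × ℕ) × Bool)

/-- Forgetting the indices of an augmented word. -/
def forgetIdx {S : Type} (w : AWord S) : Word S := w.map fun p => (p.1.1, p.2)

/-- The augmented word with all indices zero associated to a word. -/
def withZero {S : Type} (w : Word S) : AWord S := w.map fun p => ((p.1, 0), p.2)

/-- Renaming the occurrences of `s[i]` and `s[j]` to `s[min i j]`. -/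
def rename {S : Type} [DecidableEq S] (s : S) (i j : ℕ) (w : AWord S) : AWord S :=
  w.map fun p =>
    if p.1.1 = s ∧ (p.1.2 = i ∨ p.1.2 = j) then ((s, min i j), p.2) else p

/-- The projection `π_h` erasing all letters of index `≥ h`. -/
def proj {S : Type} (h : ℕ) (w : AWord S) : AWord S :=
  w.filter fun p => p.1.2 < h

/-- The projection `π₁` to ordinary words: erase all letters of positive index
and identify `s[0]` with `s`. -/
def projOne {S : Type} (w : AWord S) : Word S :=
  forgetIdx (proj 1 w)

/-- Augmented special transformations: type `0` removes a pair
`s[i]^ε s[j]^{−ε}` and renames all remaining occurrences of `s[i]`, `s[j]` to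
`s[min i j]`; types `1` and `2` commute adjacent letters whose generators
commute; type `∞` inserts a pair `s[i]^ε s[i]^{−ε}` with `i` strictly larger
than every index occurring in the word. -/
inductive AStep {S : Type} [DecidableEq S] (rel : S → S → Prop) :
    TType → AWord S → AWord S → Prop
  | free (w₁ w₂ : AWord S) (s : S) (i j : ℕ) (e : Bool) :
      AStep rel .t0 (w₁ ++ [((s, i), e), ((s, j), !e)] ++ w₂) (rename s i j (w₁ ++ w₂))
  | comm1 (w₁ w₂ : AWord S) (s t : S) (i j : ℕ) (e : Bool) (h : rel s t) :
      AStep rel .t1 (w₁ ++ [((s, i), e), ((t, j), e)] ++ w₂)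
        (w₁ ++ [((t, j), e), ((s, i), e)] ++ w₂)
  | comm2 (w₁ w₂ : AWord S) (s t : S) (i j : ℕ) (e : Bool) (h : rel s t) :
      AStep rel .t2 (w₁ ++ [((s, i), e), ((t, j), !e)] ++ w₂)
        (w₁ ++ [((t, j), !e), ((s, i), e)] ++ w₂)
  | ins (w₁ w₂ : AWord S) (s : S) (i : ℕ) (e : Bool)
      (h : ∀ p ∈ w₁ ++ w₂, p.1.2 < i) :
      AStep rel .tinf (w₁ ++ w₂) (w₁ ++ [((s, i), e), ((s, i), !e)] ++ w₂)

/-- An augmented word is regular if, for every `h ≥ 1`, either it contains no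
letter of index `h`, or it contains exactly two, forming a commutative
`h`-pair: `r[h]^ε v r[h]^{−ε}` where `r` commutes with every generator
occurring in `v` with index `< h`. -/
def Regular {S : Type} (rel : S → S → Prop) (w : AWord S) : Prop :=
  ∀ h : ℕ, 1 ≤ h →
    (∀ p ∈ w, p.1.2 ≠ h) ∨
    ∃ (w₁ v w₂ : AWord S) (r : S) (e : Bool),
      w = w₁ ++ [((r, h), e)] ++ v ++ [((r, h), !e)] ++ w₂ ∧
      (∀ p ∈ w₁ ++ v ++ w₂, p.1.2 ≠ h) ∧
      (∀ p ∈ v, p.1.2 < h → rel r p.1.1)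

/-- `k` lies strictly between `a` and `b`. -/
def Btw (a b k : ℕ) : Prop := (a < k ∧ k < b) ∨ (b < k ∧ k < a)

/-- Symmetric positional form of regularity, for partial words `f`. -/
def PReg {S : Type} (rel : S → S → Prop) (f : ℕ → Option ((S × ℕ) × Bool)) : Prop :=
  ∀ (x : ℕ) (r : S) (h : ℕ) (c : Bool), 1 ≤ h → f x = some ((r, h), c) →
    ∃ y, y ≠ x ∧ f y = some ((r, h), !c) ∧
      (∀ k r' c', f k = some ((r', h), c') → k = x ∨ k = y) ∧
      (∀ k r' h' c', Btw x y k → f k = some ((r', h'), c') → h' < h → rel r r')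

theorem get_two {α : Type} (w₁ v w₂ : List α) (p q : α) (k : ℕ) :
    (w₁ ++ [p] ++ v ++ [q] ++ w₂)[k]? = if k < w₁.length then w₁[k]? else
      if k = w₁.length then some p else
      if k < w₁.length + 1 + v.length then v[k - (w₁.length + 1)]? else
      if k = w₁.length + 1 + v.length then some q else
      w₂[k - (w₁.length + 1 + v.length + 1)]? := by
  split_ifs with c1 c2 c3 c4
  · simp [List.getElem?_append, c1]
  · subst c2; simp
  · obtain ⟨m, rfl⟩ : ∃ m, k = w₁.length + (m + 1) := ⟨k - w₁.length - 1, by omega⟩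
    have h1 : m < v.length := by omega
    have h2 : w₁.length + (m + 1) - (w₁.length + 1) = m := by omega
    simp [List.getElem?_append, h1, h2]
  · subst c4
    rw [show w₁.length + 1 + v.length = w₁.length + (v.length + 1) by omega]
    simp [List.getElem?_append]
  · obtain ⟨m, rfl⟩ : ∃ m, k = w₁.length + (v.length + (m + 1) + 1) :=
      ⟨k - w₁.length - v.length - 2, by omega⟩
    have h2 : w₁.length + (v.length + (m + 1) + 1) - (w₁.length + 1 + v.length + 1) = m := by
      omega
    simp [List.getElem?_append, h2]

theorem preg_of_regular {S : Type} (rel : S → S → Prop) (w : AWord S)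
    (H : Regular rel w) : PReg rel (fun k => w[k]?) := by
  intro x r h c hh hx
  rcases H h hh with H | ⟨w₁, v, w₂, r₀, e, rfl, h1, h2⟩
  · exact absurd rfl (H _ (List.mem_of_getElem? hx))
  · have key : ∀ k p, (w₁ ++ [((r₀, h), e)] ++ v ++ [((r₀, h), !e)] ++ w₂)[k]? = some p →
        (k = w₁.length ∧ p = ((r₀, h), e)) ∨
        (k = w₁.length + 1 + v.length ∧ p = ((r₀, h), !e)) ∨
        (p.1.2 ≠ h ∧ (w₁.length < k → k < w₁.length + 1 + v.length → p ∈ v)) := by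
      intro k p hk
      have hm : ∀ q, (q ∈ w₁ ∨ q ∈ v ∨ q ∈ w₂) → q.1.2 ≠ h := by
        intro q hq; apply h1; simp; tauto
      rw [get_two] at hk
      split_ifs at hk with c1 c2 c3 c4
      · exact Or.inr (Or.inr ⟨hm _ (Or.inl (List.mem_of_getElem? hk)), by omega⟩)
      · left; exact ⟨by omega, by simpa using hk.symm⟩
      · have := List.mem_of_getElem? hk
        exact Or.inr (Or.inr ⟨hm _ (Or.inr (Or.inl this)), fun _ _ => this⟩)
      · right; left; exact ⟨by omega, by simpa using hk.symm⟩
      · exact Or.inr (Or.inr ⟨hm _ (Or.inr (Or.inr (List.mem_of_getElem? hk))), by omega⟩)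
    have ka : (w₁ ++ [((r₀, h), e)] ++ v ++ [((r₀, h), !e)] ++ w₂)[w₁.length]? =
        some ((r₀, h), e) := by simp
    have kb : (w₁ ++ [((r₀, h), e)] ++ v ++ [((r₀, h), !e)] ++ w₂)[w₁.length + 1 + v.length]? =
        some ((r₀, h), !e) := by
      rw [get_two, if_neg (by omega), if_neg (by omega), if_neg (by omega), if_pos rfl]
    generalize (w₁ ++ [((r₀, h), e)] ++ v ++ [((r₀, h), !e)] ++ w₂) = w at *
    have hbt : ∀ k r' h' c', w₁.length < k → k < w₁.length + 1 + v.length →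
        w[k]? = some ((r', h'), c') → h' < h → rel r₀ r' := by
      intro k r' h' c' hk1 hk2 hk hlt
      rcases key k _ hk with h3 | h3 | h3
      · omega
      · omega
      · exact h2 _ (h3.2 hk1 hk2) hlt
    have huniq : ∀ k r' c', w[k]? = some ((r', h), c') →
        k = w₁.length ∨ k = w₁.length + 1 + v.length := by
      intro k r' c' hk
      rcases key k _ hk with h3 | h3 | h3
      · exact Or.inl h3.1
      · exact Or.inr h3.1
      · exact absurd rfl h3.1
    rcases key x _ hx with ⟨rfl, h3⟩ | ⟨rfl, h3⟩ | h3
    · simp only [Prod.mk.injEq, and_true] at h3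
      obtain ⟨rfl, rfl⟩ := h3
      refine ⟨_, by omega, kb, huniq, ?_⟩
      intro k r' h' c' hk
      exact hbt k r' h' c' (by unfold Btw at hk; omega) (by unfold Btw at hk; omega)
    · simp only [Prod.mk.injEq, and_true] at h3
      obtain ⟨rfl, rfl⟩ := h3
      refine ⟨w₁.length, by omega, by simpa using ka, fun k r' c' hk => (huniq k r' c' hk).symm, ?_⟩
      intro k r' h' c' hk
      exact hbt k r' h' c' (by unfold Btw at hk; omega) (by unfold Btw at hk; omega)
    · exact absurd rfl h3.1

theorem split_two {α : Type} (w : List α) (a b : ℕ) (p q : α) (hab : a < b)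
    (ha : w[a]? = some p) (hb : w[b]? = some q) :
    ∃ w₁ v w₂, w = w₁ ++ [p] ++ v ++ [q] ++ w₂ ∧ w₁.length = a ∧ a + 1 + v.length = b := by
  obtain ⟨la, rfl⟩ := List.getElem?_eq_some_iff.1 ha
  obtain ⟨lb, rfl⟩ := List.getElem?_eq_some_iff.1 hb
  refine ⟨w.take a, (w.drop (a+1)).take (b - (a+1)), w.drop (b+1), ?_, by simp; omega,
    by simp; omega⟩
  have e1 : w = w.take a ++ w.drop a := by simp
  have e2 : w.drop a = w[a] :: w.drop (a+1) := List.drop_eq_getElem_cons la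
  have e3 : w.drop (a+1) = (w.drop (a+1)).take (b-(a+1)) ++ (w.drop (a+1)).drop (b-(a+1)) := by
    simp
  have e4 : (w.drop (a+1)).drop (b-(a+1)) = w.drop b := by
    rw [List.drop_drop]; congr 1; omega
  have e5 : w.drop b = w[b] :: w.drop (b+1) := List.drop_eq_getElem_cons lb
  rw [e4, e5] at e3
  rw [e3] at e2
  rw [e2] at e1
  simpa only [List.append_assoc, List.cons_append, List.nil_append] using e1

theorem regular_of_preg {S : Type} (rel : S → S → Prop) (w : AWord S)
    (H : PReg rel (fun k => w[k]?)) : Regular rel w := by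
  intro h hh
  by_cases hn : ∀ p ∈ w, p.1.2 ≠ h
  · exact Or.inl hn
  right
  push Not at hn
  obtain ⟨⟨⟨r, h'⟩, c⟩, hp, hph⟩ := hn
  simp only at hph
  subst hph
  obtain ⟨x, hx⟩ := List.mem_iff_getElem?.1 hp
  have main : ∀ (a b : ℕ) (e : Bool), a < b → w[a]? = some ((r, h'), e) → w[b]? = some ((r, h'), !e) →
      (∀ k r' c', w[k]? = some ((r', h'), c') → k = a ∨ k = b) →
      (∀ k r' l c', a < k → k < b → w[k]? = some ((r', l), c') → l < h' → rel r r') →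
      ∃ (w₁ v w₂ : AWord S) (r : S) (e : Bool),
      w = w₁ ++ [((r, h'), e)] ++ v ++ [((r, h'), !e)] ++ w₂ ∧
      (∀ p ∈ w₁ ++ v ++ w₂, p.1.2 ≠ h') ∧
      (∀ p ∈ v, p.1.2 < h' → rel r p.1.1) := by
    intro a b e hab ha hb hu hbt
    obtain ⟨w₁, v, w₂, rfl, hl1, hl2⟩ := split_two w a b _ _ hab ha hb
    refine ⟨w₁, v, w₂, r, e, rfl, ?_, ?_⟩
    · rintro ⟨⟨r', l⟩, c'⟩ hm rfl
      simp only [List.mem_append, or_assoc] at hm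
      rcases hm with hm | hm | hm
      · obtain ⟨k, hk, hk'⟩ := List.mem_iff_getElem.1 hm
        have := hu k r' c' (by
          simp [List.getElem?_append, hk, hk'])
        omega
      · obtain ⟨k, hk, hk'⟩ := List.mem_iff_getElem.1 hm
        have := hu (w₁.length + 1 + k) r' c' (by
          simp only [List.append_assoc]
          rw [List.getElem?_append_right (by omega), List.getElem?_append_right (by simp; omega),
            List.getElem?_append_left (by simp; omega)]
          simp [← hk', List.getElem?_eq_getElem hk,
            show w₁.length + 1 + k - w₁.length - 1 = k by omega])
        omega
      · obtain ⟨k, hk, hk'⟩ := List.mem_iff_getElem.1 hm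
        have := hu (w₁.length + 1 + v.length + 1 + k) r' c' (by
          rw [List.getElem?_append_right (by simp; omega)]
          rw [← hk', ← List.getElem?_eq_getElem hk]
          congr 1; simp; omega)
        omega
    · rintro ⟨⟨r', l⟩, c'⟩ hm hlt
      obtain ⟨k, hk, hk'⟩ := List.mem_iff_getElem.1 hm
      refine hbt (w₁.length + 1 + k) r' l c' (by omega) (by omega) ?_ hlt
      simp only [List.append_assoc]
      rw [List.getElem?_append_right (by omega), List.getElem?_append_right (by simp; omega),
        List.getElem?_append_left (by simp; omega)]
      simp [← hk', List.getElem?_eq_getElem hk,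
        show w₁.length + 1 + k - w₁.length - 1 = k by omega]
  obtain ⟨y, hxy, hy, hu, hbt⟩ := H x r h' c hh hx
  rcases Nat.lt_or_ge x y with hlt | hge
  · exact main x y c hlt hx hy hu (fun k r' l c' h1 h2 => hbt k r' l c' (Or.inl ⟨h1, h2⟩))
  · exact main y x (!c) (by omega) hy (by simpa using hx) (fun k r' c' hk => (hu k r' c' hk).symm)
      (fun k r' l c' h1 h2 => hbt k r' l c' (Or.inr ⟨h1, h2⟩))

/-- Transfer along a strictly monotone reindexing. -/
theorem preg_reindex {S : Type} (rel : S → S → Prop) (f f' : ℕ → Option ((S × ℕ) × Bool))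
    (g : ℕ → ℕ) (hg : StrictMono g) (hf : ∀ k, f' k = f (g k))
    (hs : ∀ k p, f k = some p → ∃ l, g l = k) (H : PReg rel f) : PReg rel f' := by
  intro x r h c hh hx
  rw [hf] at hx
  obtain ⟨y, hxy, hy, hu, hbt⟩ := H _ r h c hh hx
  obtain ⟨z, rfl⟩ := hs _ _ hy
  refine ⟨z, fun hz => hxy (by rw [hz]), by rw [hf, hy], ?_, ?_⟩
  · intro k r' c' hk
    rw [hf] at hk
    rcases hu _ _ _ hk with h1 | h1
    · exact Or.inl (hg.injective h1)
    · exact Or.inr (hg.injective h1)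
  · intro k r' h' c' hb hk
    rw [hf] at hk
    refine hbt _ _ _ _ ?_ hk
    unfold Btw at *
    simpa only [hg.lt_iff_lt] using hb

/-- Deletion of a pair, with renaming. -/
theorem preg_free {S : Type} [DecidableEq S] (rel : S → S → Prop)
    (hsym : ∀ s t : S, rel s t → rel t s) (f g : ℕ → Option ((S × ℕ) × Bool))
    (P Q : ℕ) (s : S) (i j : ℕ) (e : Bool) (hP : f P = some ((s, i), e))
    (hQ : f Q = some ((s, j), !e)) (hPQ : P = Q + 1 ∨ Q = P + 1) (hij : i ≤ j)
    (hgP : g P = none) (hgQ : g Q = none)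
    (hg : ∀ k, k ≠ P → k ≠ Q → ∀ r h c, f k = some ((r, h), c) →
      g k = if r = s ∧ (h = i ∨ h = j) then some ((s, i), c) else some ((r, h), c))
    (hg0 : ∀ k, f k = none → g k = none)
    (H : PReg rel f) : PReg rel g := by
  have back : ∀ k r h c, g k = some ((r, h), c) → k ≠ P ∧ k ≠ Q ∧
      ((f k = some ((r, h), c) ∧ ¬ (r = s ∧ (h = i ∨ h = j))) ∨
       (r = s ∧ h = i ∧ (f k = some ((s, i), c) ∨ f k = some ((s, j), c)))) := by
    intro k r h c hk
    have h1 : k ≠ P := by rintro rfl; simp [hgP] at hk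
    have h2 : k ≠ Q := by rintro rfl; simp [hgQ] at hk
    refine ⟨h1, h2, ?_⟩
    rcases hfk : f k with _ | ⟨⟨r', h'⟩, c'⟩
    · simp [hg0 k hfk] at hk
    · rw [hg k h1 h2 r' h' c' hfk] at hk
      grind
  rcases Nat.eq_or_lt_of_le hij with rfl | hlt
  · -- equal indices
    have back' : ∀ k r h c, g k = some ((r, h), c) → k ≠ P ∧ k ≠ Q ∧ f k = some ((r, h), c) := by
      grind
    have fwd : ∀ k r h c, k ≠ P → k ≠ Q → f k = some ((r, h), c) → g k = some ((r, h), c) := by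
      grind
    intro x r h c hh hx
    obtain ⟨x1, x2, x3⟩ := back' _ _ _ _ hx
    obtain ⟨y, hxy, hy, hu, hbt⟩ := H _ _ _ _ hh x3
    have hi : h ≠ i := by
      rintro rfl
      have := hu _ _ _ hP
      have := hu _ _ _ hQ
      omega
    refine ⟨y, hxy, fwd _ _ _ _ (by grind) (by grind) hy, ?_, ?_⟩
    · intro k r' c' hk
      exact hu _ _ _ (back' _ _ _ _ hk).2.2
    · intro k r' h' c' hb hk
      exact hbt _ _ _ _ hb (back' _ _ _ _ hk).2.2
  · obtain ⟨B, hBQ, hB, huB, hbB⟩ := H Q s j (!e) (by omega) hQ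
    rw [Bool.not_not] at hB
    have hBP : B ≠ P := by rintro rfl; grind
    have hgB : g B = some ((s, i), e) := by
      rw [hg B hBP hBQ _ _ _ hB]; simp
    intro x r h c hh hx
    obtain ⟨x1, x2, x3⟩ := back _ _ _ _ hx
    rcases x3 with ⟨hfx, hne⟩ | ⟨rfl, rfl, hfx⟩
    · -- an unaffected letter
      obtain ⟨y, hxy, hy, hu, hbt⟩ := H _ _ _ _ hh hfx
      have hhj : h ≠ j := by rintro rfl; have := huB _ _ _ hfx; grind
      have hhi : h ≠ i := by
        rintro rfl
        obtain ⟨A, -, hA, huA, -⟩ := H P s h e hh hP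
        have := huA _ _ _ hfx
        grind
      have hyP : y ≠ P := by grind
      have hyQ : y ≠ Q := by grind
      have hxB : x ≠ B := by grind
      have hyB : y ≠ B := by grind
      refine ⟨y, hxy, ?_, ?_, ?_⟩
      · rw [hg y hyP hyQ _ _ _ hy, if_neg hne]
      · intro k r' c' hk
        rcases (back _ _ _ _ hk).2.2 with h1 | h1
        · exact hu _ _ _ h1.1
        · omega
      · intro k r' h' c' hb hk hlt'
        rcases (back _ _ _ _ hk).2.2 with h1 | ⟨rfl, rfl, h1 | h1⟩
        · exact hbt _ _ _ _ hb h1.1 hlt'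
        · exact hbt _ _ _ _ hb h1 hlt'
        · have hkB : k = B := by
            have := huB _ _ _ h1
            have := (back _ _ _ _ hk).2.1
            tauto
          subst hkB
          rcases Nat.lt_or_ge h j with hhj' | hhj'
          · by_cases hbP : Btw x y P
            · exact hbt _ _ _ _ hbP hP hlt'
            · have : Btw Q k x ∨ Btw Q k y := by unfold Btw at *; omega
              rcases this with h2 | h2
              · exact hsym _ _ (hbB _ _ _ _ h2 hfx hhj')
              · exact hsym _ _ (hbB _ _ _ _ h2 hy hhj')
          · exact hbt _ _ _ _ hb h1 (by omega)
    · -- the merged pair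
      obtain ⟨A, hAP, hA, huA, hbA⟩ := H P r h e hh hP
      have hAQ : A ≠ Q := by rintro rfl; grind
      have hAB : A ≠ B := by rintro rfl; grind
      have hgA : g A = some ((r, h), !e) := by
        rw [hg A hAP hAQ _ _ _ hA]; simp
      have hu : ∀ k r' c', g k = some ((r', h), c') → k = A ∨ k = B := by
        intro k r' c' hk
        obtain ⟨h1, h2, h3⟩ := back _ _ _ _ hk
        rcases h3 with h3 | ⟨-, -, h3 | h3⟩
        · have := huA _ _ _ h3.1; tauto
        · have := huA _ _ _ h3; tauto
        · have := huB _ _ _ h3; tauto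
      have hbt : ∀ k r' h' c', Btw A B k → g k = some ((r', h'), c') → h' < h → rel r r' := by
        intro k r' h' c' hb hk hlt'
        obtain ⟨h1, h2, h3⟩ := back _ _ _ _ hk
        rcases h3 with h3 | h3
        · have : Btw P A k ∨ Btw Q B k := by unfold Btw at *; omega
          rcases this with h4 | h4
          · exact hbA _ _ _ _ h4 h3.1 hlt'
          · exact hbB _ _ _ _ h4 h3.1 (by omega)
        · omega
      rcases hu _ _ _ hx with rfl | rfl
      · have hc : c = !e := by
          rw [hgA] at hx; simpa using hx.symm
        refine ⟨B, hAB.symm, by rw [hc, Bool.not_not]; exact hgB, hu, hbt⟩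
      · have hc : c = e := by
          rw [hgB] at hx; simpa using hx.symm
        refine ⟨A, hAB, by rw [hc]; exact hgA, fun k r' c' hk => (hu k r' c' hk).symm, ?_⟩
        intro k r' h' c' hb
        exact hbt _ _ _ _ (by unfold Btw at *; omega)

/-- Swapping two adjacent letters whose generators commute. -/
theorem preg_swap {S : Type} (rel : S → S → Prop)
    (hsym : ∀ s t : S, rel s t → rel t s) (f g : ℕ → Option ((S × ℕ) × Bool))
    (n : ℕ) (s t : S) (i j : ℕ) (e e' : Bool) (hP : f n = some ((s, i), e))
    (hQ : f (n+1) = some ((t, j), e')) (hst : rel s t)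
    (hgP : g n = f (n+1)) (hgQ : g (n+1) = f n)
    (hg : ∀ k, k ≠ n → k ≠ n+1 → g k = f k)
    (H : PReg rel f) : PReg rel g := by
  have hts := hsym _ _ hst
  obtain ⟨σ, hσ⟩ : ∃ σ : ℕ → ℕ, ∀ k, σ k = if k = n then n+1 else if k = n+1 then n else k :=
    ⟨_, fun _ => rfl⟩
  have hσσ : ∀ k, σ (σ k) = k := by intro k; rw [hσ (σ k), hσ k]; split_ifs <;> omega
  have hgf : ∀ k, g k = f (σ k) := by
    intro k; rw [hσ]; split_ifs with h1 h2
    · rw [h1, hgP]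
    · rw [h2, hgQ]
    · exact hg k h1 h2
  intro x r h c hh hx
  rw [hgf] at hx
  obtain ⟨y, hxy, hy, hu, hbt⟩ := H _ _ _ _ hh hx
  refine ⟨σ y, fun h1 => hxy (by rw [← h1, hσσ]), by rw [hgf, hσσ, hy], ?_, ?_⟩
  · intro k r' c' hk
    rw [hgf] at hk
    rcases hu _ _ _ hk with h1 | h1
    · left; rw [← hσσ k, h1, hσσ]
    · right; rw [← hσσ k, h1]
  · intro k r' h' c' hb hk hlt
    rw [hgf] at hk
    by_cases hb' : Btw (σ x) y (σ k)
    · exact hbt _ _ _ _ hb' hk hlt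
    · have hkx : k ≠ x := by unfold Btw at hb; omega
      have hky : k ≠ σ y := by unfold Btw at hb; omega
      have hxy' : x ≠ σ y := by rintro rfl; exact hxy (hσσ y).symm
      -- one of the two ends of the pair is swapped with `k`
      have : (σ k = n ∧ (σ x = n+1 ∨ y = n+1)) ∨ (σ k = n+1 ∧ (σ x = n ∨ y = n)) := by
        have e1 := hσ x
        have e2 := hσ y
        have e3 := hσ k
        unfold Btw at *
        split_ifs at e1 e2 e3 <;> omega
      rcases this with ⟨h1, h2 | h2⟩ | ⟨h1, h2 | h2⟩
      all_goals
        rw [h1] at hk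
        first | rw [h2] at hx | rw [h2] at hy
        grind

/-- Inserting a pair of fresh maximal index. -/
theorem preg_ins {S : Type} (rel : S → S → Prop) (f g : ℕ → Option ((S × ℕ) × Bool))
    (n : ℕ) (s : S) (i : ℕ) (e : Bool) (hfn : f n = none) (hfn' : f (n+1) = none)
    (hP : g n = some ((s, i), e)) (hQ : g (n+1) = some ((s, i), !e))
    (hg : ∀ k, k ≠ n → k ≠ n+1 → g k = f k)
    (hi : ∀ k r h c, f k = some ((r, h), c) → h < i)
    (H : PReg rel f) : PReg rel g := by
  have back : ∀ k r h c, g k = some ((r, h), c) → ((k = n ∨ k = n+1) ∧ h = i) ∨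
      (k ≠ n ∧ k ≠ n+1 ∧ f k = some ((r, h), c)) := by
    intro k r h c hk
    by_cases h1 : k = n
    · grind
    by_cases h2 : k = n+1
    · grind
    rw [hg k h1 h2] at hk
    exact Or.inr ⟨h1, h2, hk⟩
  have hui : ∀ k r c, g k = some ((r, i), c) → k = n ∨ k = n+1 := by
    intro k r c hk
    rcases back _ _ _ _ hk with h1 | h1
    · exact h1.1
    · exact absurd (hi _ _ _ _ h1.2.2) (by omega)
  intro x r h c hh hx
  rcases back _ _ _ _ hx with ⟨h1 | h1, rfl⟩ | ⟨h1, h2, h3⟩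
  · subst h1
    refine ⟨x+1, by omega, by grind, hui, ?_⟩
    intro k _ _ _ hb; unfold Btw at hb; omega
  · subst h1
    have hc : c = !e := by
      rw [hQ] at hx; simp at hx; rw [hx.2, Bool.not_not]
    have hr : s = r := by
      rw [hQ] at hx; simp at hx; exact hx.1
    refine ⟨n, by omega, by rw [hc, Bool.not_not, ← hr]; exact hP, fun k r c hk => (hui k r c hk).symm, ?_⟩
    intro k _ _ _ hb; unfold Btw at hb; omega
  · have hlt := hi _ _ _ _ h3
    obtain ⟨y, hxy, hy, hu, hbt⟩ := H _ _ _ _ hh h3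
    refine ⟨y, hxy, ?_, ?_, ?_⟩
    · rw [hg y (by grind) (by grind), hy]
    · intro k r' c' hk
      rcases back _ _ _ _ hk with h4 | h4
      · omega
      · exact hu _ _ _ h4.2.2
    · intro k r' h' c' hb hk hl
      rcases back _ _ _ _ hk with h4 | h4
      · omega
      · exact hbt _ _ _ _ hb h4.2.2 hl

theorem swap_regular {S : Type} (rel : S → S → Prop)
    (hsym : ∀ s t : S, rel s t → rel t s) (w₁ w₂ : AWord S) (s t : S) (i j : ℕ) (e e' : Bool)
    (hst : rel s t) (H : Regular rel (w₁ ++ [((s, i), e), ((t, j), e')] ++ w₂)) :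
    Regular rel (w₁ ++ [((t, j), e'), ((s, i), e)] ++ w₂) := by
  apply regular_of_preg
  refine preg_swap rel hsym _ _ w₁.length s t i j e e' ?_ ?_ hst ?_ ?_ ?_
    (preg_of_regular rel _ H)
  · simp
  · simp [List.getElem?_append]
  · simp [List.getElem?_append]
  · simp [List.getElem?_append]
  · intro k h1 h2
    rcases Nat.lt_or_ge k w₁.length with h3 | h3
    · simp [List.getElem?_append, h3]
    · obtain ⟨m, rfl⟩ : ∃ m, k = w₁.length + (m + 2) := ⟨k - w₁.length - 2, by omega⟩
      simp [List.getElem?_append]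

/-- The partial word obtained from `w₁ w₂` by leaving two holes in the middle. -/
def holes {S : Type} (w₁ w₂ : AWord S) (k : ℕ) : Option ((S × ℕ) × Bool) :=
  if k < w₁.length then w₁[k]? else if k < w₁.length + 2 then none
  else w₂[k - (w₁.length + 2)]?

theorem preg_of_holes {S : Type} (rel : S → S → Prop) (w₁ w₂ : AWord S)
    (H : PReg rel (holes w₁ w₂)) : PReg rel (fun k => (w₁ ++ w₂)[k]?) := by
  refine preg_reindex rel _ _ (fun k => if k < w₁.length then k else k + 2) ?_ ?_ ?_ H
  · intro a b hab
    show (if a < w₁.length then a else a + 2) < (if b < w₁.length then b else b + 2)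
    split_ifs <;> omega
  · intro k
    simp only [holes, List.getElem?_append]
    split_ifs <;> first | rfl | omega | (congr 1; omega)
  · intro k p hk
    simp only [holes] at hk
    split_ifs at hk with h1 h2
    · exact ⟨k, by simp [h1]⟩
    · refine ⟨k - 2, ?_⟩
      split_ifs <;> omega

theorem holes_of_preg {S : Type} (rel : S → S → Prop) (w₁ w₂ : AWord S)
    (H : PReg rel (fun k => (w₁ ++ w₂)[k]?)) : PReg rel (holes w₁ w₂) := by
  have hc : ∀ k p, holes w₁ w₂ k = some p → k < w₁.length ∨ w₁.length + 2 ≤ k := by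
    intro k p hk
    simp only [holes] at hk
    split_ifs at hk <;> omega
  obtain ⟨d, hd⟩ : ∃ d : ℕ → ℕ, ∀ k, d k = if k < w₁.length then k else k - 2 := ⟨_, fun _ => rfl⟩
  obtain ⟨u, hu'⟩ : ∃ u : ℕ → ℕ, ∀ k, u k = if k < w₁.length then k else k + 2 := ⟨_, fun _ => rfl⟩
  have hdn : ∀ k p, holes w₁ w₂ k = some p → (w₁ ++ w₂)[d k]? = some p := by
    intro k p hk
    have := hc k p hk
    simp only [holes] at hk
    rw [hd, List.getElem?_append]
    split_ifs at hk ⊢ <;> first | omega | exact hk | (rw [← hk]; congr 1; omega)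
  have hup : ∀ k, holes w₁ w₂ (u k) = (w₁ ++ w₂)[k]? := by
    intro k
    rw [hu', List.getElem?_append]
    simp only [holes]
    split_ifs <;> first | rfl | omega | (congr 1; omega)
  intro x r h c hh hx
  have hx' := hc _ _ hx
  obtain ⟨y, hxy, hy, hu, hbt⟩ := H _ _ _ _ hh (hdn _ _ hx)
  refine ⟨u y, ?_, ?_, ?_, ?_⟩
  · have := hd x; have := hu' y
    split_ifs at * <;> omega
  · rw [hup]; exact hy
  · intro k r' c' hk
    have hk' := hc _ _ hk
    have h1 := hu _ _ _ (hdn _ _ hk)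
    have := hd x; have := hu' y; have := hd k
    split_ifs at * <;> omega
  · intro k r' h' c' hb hk
    have hk' := hc _ _ hk
    refine hbt (d k) _ _ _ ?_ (hdn _ _ hk)
    have := hd x; have := hu' y; have := hd k
    unfold Btw at *
    split_ifs at * <;> omega

/-- in the right-angled augmented-word setting, regularity is
preserved by every augmented special transformation (of type `0`, `1`, `2`,
or `∞`). -/
theorem regular_preserved {S : Type} [DecidableEq S]
    (rel : S → S → Prop) (hsym : ∀ s t : S, rel s t → rel t s)
    (ty : TType) (w w' : AWord S)
    (hreg : Regular rel w) (hstep : AStep rel ty w w') :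
    Regular rel w' := by
  cases hstep with
  | free w₁ w₂ s i j e =>
    apply regular_of_preg
    have hr : rename s i j (w₁ ++ w₂) = rename s i j w₁ ++ rename s i j w₂ := by simp [rename]
    rw [hr]
    apply preg_of_holes
    have H := preg_of_regular rel _ hreg
    have hl : (rename s i j w₁).length = w₁.length := by simp [rename]
    have f1 : (w₁ ++ [((s, i), e), ((s, j), !e)] ++ w₂)[w₁.length]? = some ((s, i), e) := by simp
    have f2 : (w₁ ++ [((s, i), e), ((s, j), !e)] ++ w₂)[w₁.length + 1]? = some ((s, j), !e) := by
      simp [List.getElem?_append]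
    have g1 : holes (rename s i j w₁) (rename s i j w₂) w₁.length = none := by simp [holes, hl]
    have g2 : holes (rename s i j w₁) (rename s i j w₂) (w₁.length + 1) = none := by
      simp [holes, hl]
    have g3 : ∀ k, k ≠ w₁.length → k ≠ w₁.length + 1 →
        holes (rename s i j w₁) (rename s i j w₂) k =
        ((w₁ ++ [((s, i), e), ((s, j), !e)] ++ w₂)[k]?).map fun p =>
          if p.1.1 = s ∧ (p.1.2 = i ∨ p.1.2 = j) then ((s, min i j), p.2) else p := by
      intro k h1 h2
      rcases Nat.lt_or_ge k w₁.length with h3 | h3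
      · simp [holes, hl, h3, rename, List.getElem?_append]
      · obtain ⟨m, rfl⟩ : ∃ m, k = w₁.length + (m + 2) := ⟨k - w₁.length - 2, by omega⟩
        have : w₁.length + (m + 2) - (w₁.length + 2) = m := by omega
        simp [holes, hl, rename, List.getElem?_append, this]
    have g4 : ∀ k, (w₁ ++ [((s, i), e), ((s, j), !e)] ++ w₂)[k]? = none →
        holes (rename s i j w₁) (rename s i j w₂) k = none := by
      intro k hk
      by_cases h1 : k = w₁.length
      · rw [h1, g1]
      by_cases h2 : k = w₁.length + 1
      · rw [h2, g2]
      rw [g3 k h1 h2, hk]; rfl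
    rcases Nat.le_total i j with hij | hij
    · refine preg_free rel hsym _ _ w₁.length (w₁.length + 1) s i j e f1 f2 (Or.inr rfl) hij g1 g2
        ?_ g4 H
      intro k h1 h2 r h c hk
      rw [g3 k h1 h2, hk, min_eq_left hij]
      simp only [Option.map_some]
      split_ifs <;> rfl
    · refine preg_free rel hsym _ _ (w₁.length + 1) w₁.length s j i (!e) f2 (by simpa using f1)
        (Or.inl rfl) hij g2 g1 ?_ g4 H
      intro k h1 h2 r h c hk
      rw [g3 k h2 h1, hk, min_eq_right hij]
      simp only [Option.map_some, or_comm]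
      split_ifs <;> rfl
  | comm1 w₁ w₂ s t i j e h => exact swap_regular rel hsym w₁ w₂ s t i j e e h hreg
  | comm2 w₁ w₂ s t i j e h => exact swap_regular rel hsym w₁ w₂ s t i j e (!e) h hreg
  | ins w₁ w₂ s i e h =>
    apply regular_of_preg
    refine preg_ins rel (holes w₁ w₂) _ w₁.length s i e ?_ ?_ ?_ ?_ ?_ ?_
      (holes_of_preg rel w₁ w₂ (preg_of_regular rel _ hreg))
    · simp [holes]
    · simp [holes]
    · simp
    · simp [List.getElem?_append]
    · intro k h1 h2
      rcases Nat.lt_or_ge k w₁.length with h3 | h3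
      · simp [holes, h3, List.getElem?_append]
      · obtain ⟨m, rfl⟩ : ∃ m, k = w₁.length + (m + 2) := ⟨k - w₁.length - 2, by omega⟩
        have : w₁.length + (m + 2) - (w₁.length + 2) = m := by omega
        simp [holes, List.getElem?_append, this]
    · intro k r l c hk
      refine h ((r, l), c) ?_
      simp only [holes] at hk
      rw [List.mem_append]
      split_ifs at hk
      · exact Or.inl (List.mem_of_getElem? hk)
      · exact Or.inr (List.mem_of_getElem? hk)

end ArtinConj
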